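/- arXiv:2601.13908 — 3 statements merged into one kernel-verified Lean document; each statement's English description precedes it below -/
import Mathlib

section
/- Assume the matrix K is invertible and set A = K⁻¹M. Then for every integer k with 0 ≤ k ≤ N−1 and every index 0 ≤ p ≤ N, the ADER matrix A integrates power functions exactly at the nodes: Σ_{q=0}^{N} A_{pq} · τ_q^{k} = τ_p^{k+1}/(k+1). -/
open MeasureTheory Matrix Polynomial Topology Filter

/-- A polynomial of degree at most `2N + 1` that vanishes at the `N + 1` Gauss nodes has
integral zero over `[0, 1]`. -/
theorem integral_eq_zero_of_eval_gauss_nodes_eq_zero {N : ℕ} {τ : Fin (N + 1) → ℝ}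
    (hτ : Function.Injective τ)
    (horth : ∀ j : ℕ, j ≤ N → ∫ ξ in (0:ℝ)..1, ξ ^ j * ∏ k, (ξ - τ k) = 0)
    {f : ℝ[X]} (hdeg : f.natDegree ≤ 2 * N + 1) (hf : ∀ k, f.eval (τ k) = 0) :
    ∫ t in (0:ℝ)..1, f.eval t = 0 := by
  obtain ⟨Q, rfl⟩ : (∏ k, (X - C (τ k))) ∣ f := by
    refine Finset.prod_dvd_of_coprime ?_ fun k _ => dvd_iff_isRoot.mpr (hf k)
    exact (pairwise_coprime_X_sub_C hτ).set_pairwise _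
  rcases eq_or_ne Q 0 with rfl | hQ
  · simp
  have hmonic : (∏ k, (X - C (τ k))).Monic := monic_prod_of_monic _ _ fun k _ => monic_X_sub_C _
  have hQdeg : Q.natDegree ≤ N := by
    rw [hmonic.natDegree_mul' hQ, natDegree_prod_of_monic _ _ fun k _ => monic_X_sub_C _] at hdeg
    simp at hdeg
    omega
  have hexp (t : ℝ) : ((∏ k, (X - C (τ k))) * Q).eval t =
      ∑ j ∈ Finset.range (Q.natDegree + 1), Q.coeff j * (t ^ j * ∏ k, (t - τ k)) := by
    rw [eval_mul, eval_eq_sum_range (p := Q), Finset.mul_sum]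
    refine Finset.sum_congr rfl fun j _ => ?_
    simp only [eval_prod, eval_sub, eval_X, eval_C]
    ring
  simp_rw [hexp]
  rw [intervalIntegral.integral_finsetSum
    fun j _ => Continuous.intervalIntegrable (by fun_prop) _ _]
  refine Finset.sum_eq_zero fun j hj => ?_
  rw [intervalIntegral.integral_const_mul, horth j (by simp at hj; omega), mul_zero]

/-- A polynomial of degree at most `N` equals its Lagrange interpolant at `N + 1` nodes. -/
theorem sum_C_eval_mul_lagrange_basis {N : ℕ} {τ : Fin (N + 1) → ℝ}
    (hτ : Function.Injective τ) {φ : Fin (N + 1) → ℝ[X]} (hφdeg : ∀ p, (φ p).natDegree ≤ N)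
    (hφeval : ∀ p q, (φ p).eval (τ q) = if p = q then 1 else 0)
    {P : ℝ[X]} (hP : P.natDegree ≤ N) :
    ∑ q, C (P.eval (τ q)) * φ q = P := by
  have hlt {f : ℝ[X]} (hf : f.natDegree ≤ N) :
      f.degree < (Finset.univ : Finset (Fin (N + 1))).card := by
    rw [Finset.card_univ, Fintype.card_fin]
    exact (natDegree_le_iff_degree_le.mp hf).trans_lt (by exact_mod_cast Nat.lt_succ_self N)
  refine eq_of_degrees_lt_of_eval_index_eq Finset.univ hτ.injOn (hlt ?_) (hlt hP) ?_
  · exact natDegree_sum_le_of_forall_le _ _ fun q _ => (natDegree_C_mul_le _ _).trans (hφdeg q)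
  · intro p _
    simp [eval_finsetSum, hφeval]

/-- The ADER matrix `A = K⁻¹M` integrates power functions exactly at the nodes. -/
theorem aderdg_A_integrates_powers
    (N : ℕ) (hN : 1 ≤ N)
    (τ : Fin (N + 1) → ℝ) (hτ : StrictMono τ)
    (hτmem : ∀ k, τ k ∈ Set.Ioo (0 : ℝ) 1)
    (horth : ∀ j : ℕ, j ≤ N →
      ∫ ξ in (0:ℝ)..1, ξ ^ j * ∏ k, (ξ - τ k) = 0)
    (φ : Fin (N + 1) → Polynomial ℝ)
    (hφdeg : ∀ p, (φ p).natDegree ≤ N)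
    (hφeval : ∀ p q, (φ p).eval (τ q) = if p = q then 1 else 0)
    (w : Fin (N + 1) → ℝ)
    (hw : ∀ p, w p = ∫ t in (0:ℝ)..1, (φ p).eval t)
    (K : Matrix (Fin (N + 1)) (Fin (N + 1)) ℝ)
    (hK : ∀ p q, K p q = (φ p).eval 0 * (φ q).eval 0 +
      ∫ t in (0:ℝ)..1, (φ p).eval t * (φ q).derivative.eval t)
    (hKdet : IsUnit K.det)
    (A : Matrix (Fin (N + 1)) (Fin (N + 1)) ℝ)
    (hA : A = K⁻¹ * Matrix.diagonal w)
    :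
    ∀ k : ℕ, k ≤ N - 1 → ∀ p,
      ∑ q, A p q * (τ q) ^ k = (τ p) ^ (k + 1) / ((k : ℝ) + 1) := by
  intro k hk p
  subst hA
  have hinj := hτ.injective
  set P : ℝ[X] := C (1 / ((k : ℝ) + 1)) * X ^ (k + 1) with hPdef
  have hk0 : (k : ℝ) + 1 ≠ 0 := by positivity
  have hP : P.natDegree ≤ N := (natDegree_C_mul_X_pow_le _ _).trans (by omega)
  have hPeval (t : ℝ) : P.eval t = t ^ (k + 1) / ((k : ℝ) + 1) := by
    simp [hPdef]
    ring
  have hPder (t : ℝ) : P.derivative.eval t = t ^ k := by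
    simp [hPdef]
    field_simp
  have hsum := sum_C_eval_mul_lagrange_basis hinj hφdeg hφeval hP
  have hsum0 : ∑ q, (φ q).eval 0 * P.eval (τ q) = 0 := by
    have h := congrArg (eval 0) hsum
    simp only [eval_finsetSum, eval_mul, eval_C] at h
    rw [hPeval 0, zero_pow k.succ_ne_zero, zero_div] at h
    simpa only [mul_comm] using h
  have hsumder (t : ℝ) : ∑ q, (φ q).derivative.eval t * P.eval (τ q) = t ^ k := by
    have h := congrArg (fun f => f.derivative.eval t) hsum
    simp only [derivative_sum, derivative_C_mul, eval_finsetSum, eval_mul, eval_C, hPder] at h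
    simpa only [mul_comm] using h
  have hquad (i) : ∫ t in (0:ℝ)..1, (φ i).eval t * t ^ k = w i * τ i ^ k := by
    have h := integral_eq_zero_of_eval_gauss_nodes_eq_zero hinj horth
      (f := φ i * X ^ k - φ i * C (τ i ^ k)) ?_ ?_
    · simp only [eval_sub, eval_mul, eval_pow, eval_X, eval_C] at h
      rw [intervalIntegral.integral_sub (Continuous.intervalIntegrable (by fun_prop) _ _)
        (Continuous.intervalIntegrable (by fun_prop) _ _),
        intervalIntegral.integral_mul_const, ← hw, sub_eq_zero] at h
      exact h
    · have hi := hφdeg i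
      refine (natDegree_sub_le_of_le (m := N + k) (n := N) ?_ ?_).trans
        (max_le (by omega) (by omega))
      · exact natDegree_mul_le_of_le hi (natDegree_X_pow_le k)
      · exact (natDegree_mul_C_le _ _).trans hi
    · intro q
      by_cases hq : i = q <;> simp [hφeval, hq]
  have hKv : K *ᵥ (fun q => P.eval (τ q)) = diagonal w *ᵥ fun q => τ q ^ k := by
    ext i
    rw [mulVec_diagonal, ← hquad i]
    simp only [mulVec, dotProduct, hK, add_mul, Finset.sum_add_distrib, mul_assoc,
      ← Finset.mul_sum, hsum0, mul_zero, zero_add, ← intervalIntegral.integral_mul_const]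
    rw [← intervalIntegral.integral_finsetSum
      fun j _ => Continuous.intervalIntegrable (by fun_prop) _ _]
    simp only [← Finset.mul_sum, hsumder]
  have hAv : (K⁻¹ * diagonal w) *ᵥ (fun q => τ q ^ k) = fun q => P.eval (τ q) := by
    rw [← mulVec_mulVec, ← hKv, mulVec_mulVec, nonsing_inv_mul K hKdet, one_mulVec]
  exact (congrFun hAv p).trans (hPeval _)
end

section
/- Assume the matrix K is invertible and set A = K⁻¹M. Let D ≥ 1 be an integer, u_n ∈ ℝ^D, Δt ∈ ℝ, and let F_0, …, F_N ∈ ℝ^D be arbitrary vectors. If the vectors q̂_0, …, q̂_N ∈ ℝ^D satisfy the local DG predictor system q̂_p = u_n + Δt · Σ_{q=0}^{N} A_{pq} F_q for every 0 ≤ p ≤ N, then the local solution evaluated at the right endpoint τ = 1 coincides with the ADER-DG node update: Σ_{p=0}^{N} φ_p(1) · q̂_p = u_n + Δt · Σ_{q=0}^{N} w_q F_q. -/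
open MeasureTheory Matrix Polynomial Topology Filter

/-- Polynomials of degree at most `N` that form the Lagrange basis of `N + 1` distinct nodes
sum to one. -/
lemma sum_eq_one_of_eval_nodes {N : ℕ} {τ : Fin (N + 1) → ℝ} (hτ : Function.Injective τ)
    {φ : Fin (N + 1) → Polynomial ℝ} (hφdeg : ∀ p, (φ p).natDegree ≤ N)
    (hφeval : ∀ p q, (φ p).eval (τ q) = if p = q then 1 else 0) :
    ∑ p, φ p = 1 := by
  refine Polynomial.eq_of_degrees_lt_of_eval_index_eq (s := Finset.univ) (v := τ)
    hτ.injOn ?_ ?_ ?_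
  · rw [Finset.card_univ, Fintype.card_fin]
    refine (Polynomial.degree_le_of_natDegree_le
      (Polynomial.natDegree_sum_le_of_forall_le _ _ fun p _ => hφdeg p)).trans_lt ?_
    exact_mod_cast N.lt_succ_self
  · rw [Finset.card_univ, Fintype.card_fin, Polynomial.degree_one]
    exact_mod_cast Nat.succ_pos N
  · intro q _
    simp [Polynomial.eval_finsetSum, hφeval]

/-- The fundamental theorem of calculus for a real polynomial on `[a, b]`. -/
lemma integral_eval_derivative (P : Polynomial ℝ) (a b : ℝ) :
    ∫ t in a..b, P.derivative.eval t = P.eval b - P.eval a :=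
  intervalIntegral.integral_eq_sub_of_hasDerivAt (fun t _ => P.hasDerivAt t)
    (P.derivative.continuous.intervalIntegrable a b)

/-- The columns of the DG stiffness matrix sum to the basis values at the right endpoint. -/
lemma sum_stiffness_column {ι : Type*} [Fintype ι] {φ : ι → Polynomial ℝ}
    (hφ : ∑ p, φ p = 1) (q : ι) :
    ∑ p, ((φ p).eval 0 * (φ q).eval 0 +
      ∫ t in (0:ℝ)..1, (φ p).eval t * (φ q).derivative.eval t) = (φ q).eval 1 := by
  have hsum (t : ℝ) : ∑ p, (φ p).eval t = 1 := by
    rw [← Polynomial.eval_finsetSum, hφ, Polynomial.eval_one]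
  have hintegrable : ∀ p ∈ Finset.univ, IntervalIntegrable
      (fun t => (φ p).eval t * (φ q).derivative.eval t) volume 0 1 := fun p _ =>
    ((φ p).continuous.mul (φ q).derivative.continuous).intervalIntegrable 0 1
  rw [Finset.sum_add_distrib, ← Finset.sum_mul, hsum, one_mul,
    ← intervalIntegral.integral_finsetSum hintegrable]
  simp only [← Finset.sum_mul, hsum, one_mul]
  rw [integral_eval_derivative]
  ring

/-- The local DG predictor solution evaluated at `τ = 1` coincides with the
ADER-DG node update. -/
theorem aderdg_local_solution_right_endpoint
    (N : ℕ) (hN : 1 ≤ N)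
    (τ : Fin (N + 1) → ℝ) (hτ : StrictMono τ)
    (hτmem : ∀ k, τ k ∈ Set.Ioo (0 : ℝ) 1)
    (horth : ∀ j : ℕ, j ≤ N →
      ∫ ξ in (0:ℝ)..1, ξ ^ j * ∏ k, (ξ - τ k) = 0)
    (φ : Fin (N + 1) → Polynomial ℝ)
    (hφdeg : ∀ p, (φ p).natDegree ≤ N)
    (hφeval : ∀ p q, (φ p).eval (τ q) = if p = q then 1 else 0)
    (w : Fin (N + 1) → ℝ)
    (hw : ∀ p, w p = ∫ t in (0:ℝ)..1, (φ p).eval t)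
    (K : Matrix (Fin (N + 1)) (Fin (N + 1)) ℝ)
    (hK : ∀ p q, K p q = (φ p).eval 0 * (φ q).eval 0 +
      ∫ t in (0:ℝ)..1, (φ p).eval t * (φ q).derivative.eval t)
    (hKdet : IsUnit K.det)
    (A : Matrix (Fin (N + 1)) (Fin (N + 1)) ℝ)
    (hA : A = K⁻¹ * Matrix.diagonal w)
    (D : ℕ) (hD : 1 ≤ D)
    (un : Fin D → ℝ) (Δt : ℝ)
    (Fv : Fin (N + 1) → Fin D → ℝ)
    (qh : Fin (N + 1) → Fin D → ℝ)
    (hqh : ∀ p, qh p = un + Δt • ∑ q, A p q • Fv q) :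
    ∑ p, (φ p).eval 1 • qh p = un + Δt • ∑ q, w q • Fv q := by
  have hφ : ∑ p, φ p = 1 := sum_eq_one_of_eval_nodes hτ.injective hφdeg hφeval
  have hone : ∑ p, (φ p).eval 1 = 1 := by
    rw [← Polynomial.eval_finsetSum, hφ, Polynomial.eval_one]
  have hcol : (1 : Fin (N + 1) → ℝ) ᵥ* K = fun q => (φ q).eval 1 := by
    ext q
    simp only [Matrix.vecMul, dotProduct, Pi.one_apply, one_mul, hK]
    exact sum_stiffness_column hφ q
  have hweights : (fun p => (φ p).eval 1) ᵥ* A = w := by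
    rw [← hcol, hA, Matrix.vecMul_vecMul, Matrix.mul_nonsing_inv_cancel_left _ _ hKdet]
    ext q
    simp [Matrix.vecMul_diagonal]
  have hcolA (q : Fin (N + 1)) : ∑ p, (φ p).eval 1 * A p q = w q := congrFun hweights q
  simp only [hqh, smul_add, Finset.sum_add_distrib, ← Finset.sum_smul, hone, one_smul,
    smul_comm _ Δt, ← Finset.smul_sum]
  simp only [Finset.smul_sum (s := Finset.univ) (f := fun q => A _ q • Fv q), smul_smul]
  rw [Finset.sum_comm]
  simp only [← Finset.sum_smul, hcolA]
end

section
/- Approximation order N+1 of the local DG predictor solution: assume the matrix K is invertible and set A = K⁻¹M. Let D ≥ 1, t_0 < t_f, let L_F ≥ 0, let F : ℝ^D × ℝ → ℝ^D satisfy the Lipschitz condition ‖F(x,t) − F(y,t)‖ ≤ L_F ‖x − y‖ for all x, y ∈ ℝ^D and all t ∈ [t_0, t_f], and let u : [t_0, t_f] → ℝ^D be (N+2)-times continuously differentiable with u'(t) = F(u(t), t) for all t ∈ [t_0, t_f]. Fix C_u ≥ 0. Then there exist constants C > 0 and h₀ > 0 such that for every integer M ≥ 1 with Δt := (t_f − t_0)/M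 ≤ h₀, and for every family of node values u_n ∈ ℝ^D (0 ≤ n ≤ M) and predictor coefficients q̂_{n,p} ∈ ℝ^D (0 ≤ n < M, 0 ≤ p ≤ N) satisfying (i) q̂_{n,p} = u_n + Δt · Σ_{q=0}^{N} A_{pq} F(q̂_{n,q}, t_n + τ_q Δt) for all n, p, where t_n = t_0 + nΔt, and (ii) ‖u_n − u(t_n)‖ ≤ C_u · Δt^{2N+1} for all 0 ≤ n ≤ M, one has sup_{0 ≤ n < M} sup_{τ ∈ [0,1]} ‖Σ_{p=0}^{N} q̂_{n,p} φ_p(τ) − u(t_n + τΔt)‖ ≤ C · Δt^{N+1}. -/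
open MeasureTheory Matrix Polynomial Topology Filter

/-- Every real polynomial has a polynomial antiderivative with a prescribed value at `0`. -/
theorem exists_antiderivative (p : ℝ[X]) (c : ℝ) :
    ∃ q : ℝ[X], derivative q = p ∧ q.eval 0 = c ∧ q.natDegree ≤ p.natDegree + 1 := by
  refine ⟨C c + ∑ i ∈ Finset.range (p.natDegree + 1), monomial (i + 1) (p.coeff i / (i + 1)),
    ?_, ?_, ?_⟩
  · conv_rhs => rw [p.as_sum_range]
    rw [derivative_add, derivative_C, zero_add, derivative_sum]
    refine Finset.sum_congr rfl fun i _ => ?_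
    rw [derivative_monomial]
    have : (i : ℝ) + 1 ≠ 0 := by positivity
    simp [this]
  · simp [eval_finsetSum]
  · refine natDegree_add_le_of_degree_le (by simp) (natDegree_sum_le_of_forall_le _ _ fun i hi => ?_)
    exact (natDegree_monomial_le _).trans (by simpa using Finset.mem_range.1 hi)

/-- Mean value estimate comparing a polynomial in the scaled variable with a function. -/
theorem abs_eval_sub_le_of_derivative {t0 tf a h E : ℝ} {f g : ℝ → ℝ} {v : ℝ[X]}
    (hf : ∀ t ∈ Set.Icc t0 tf, HasDerivWithinAt f (g t) (Set.Icc t0 tf) t)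
    (hmem : ∀ s ∈ Set.Icc (0 : ℝ) 1, a + s * h ∈ Set.Icc t0 tf)
    (hv0 : v.eval 0 = f a)
    (hv : ∀ s ∈ Set.Icc (0 : ℝ) 1, |v.derivative.eval s - h * g (a + s * h)| ≤ E) :
    ∀ s ∈ Set.Icc (0 : ℝ) 1, |v.eval s - f (a + s * h)| ≤ E := by
  intro s hs
  have hE : 0 ≤ E := (abs_nonneg _).trans (hv s hs)
  have hd : ∀ x ∈ Set.Icc (0 : ℝ) 1, HasDerivWithinAt (fun s => v.eval s - f (a + s * h))
      (v.derivative.eval x - h * g (a + x * h)) (Set.Icc 0 1) x := by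
    intro x hx
    have hl : HasDerivWithinAt (fun s : ℝ => a + s * h) h (Set.Icc 0 1) x := by
      simpa using (((hasDerivAt_id x).mul_const h).const_add a).hasDerivWithinAt
    have hc := (hf _ (hmem x hx)).scomp x hl hmem
    exact (v.hasDerivAt x).hasDerivWithinAt.sub (by simpa [Function.comp_def] using hc)
  have := norm_image_sub_le_of_norm_deriv_le_segment' hd
    (fun x hx => by simpa using hv x ⟨hx.1, hx.2.le⟩) s hs
  simp only [Real.norm_eq_abs, hv0, zero_mul, add_zero, sub_self, sub_zero] at this
  exact this.trans (mul_le_of_le_one_right hE hs.2)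

/-- Uniform local polynomial approximation, simultaneously for a function and its derivative. -/
theorem exists_uniform_polynomial_approx {t0 tf : ℝ} (htf : t0 < tf) (n : ℕ) :
    ∀ f : ℝ → ℝ, ContDiffOn ℝ (n + 1 : ℕ) f (Set.Icc t0 tf) →
    ∃ B : ℝ, 0 ≤ B ∧ ∀ a h : ℝ, 0 ≤ h →
      (∀ s ∈ Set.Icc (0 : ℝ) 1, a + s * h ∈ Set.Icc t0 tf) →
      ∃ v : ℝ[X], v.natDegree ≤ n ∧ v.eval 0 = f a ∧
        (∀ s ∈ Set.Icc (0 : ℝ) 1, |v.eval s - f (a + s * h)| ≤ B * h ^ (n + 1)) ∧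
        ∀ s ∈ Set.Icc (0 : ℝ) 1,
          |v.derivative.eval s - h * derivWithin f (Set.Icc t0 tf) (a + s * h)|
            ≤ B * h ^ (n + 1) := by
  have hderiv : ∀ (k : ℕ) (f : ℝ → ℝ), ContDiffOn ℝ (k + 1 : ℕ) f (Set.Icc t0 tf) →
      ∀ t ∈ Set.Icc t0 tf,
        HasDerivWithinAt f (derivWithin f (Set.Icc t0 tf) t) (Set.Icc t0 tf) t :=
    fun k f hf t ht => (hf.differentiableOn (by simp) t ht).hasDerivWithinAt
  induction n with
  | zero =>
    intro f hf
    have hc : ContinuousOn (derivWithin f (Set.Icc t0 tf)) (Set.Icc t0 tf) :=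
      hf.continuousOn_derivWithin (uniqueDiffOn_Icc htf) (by simp)
    obtain ⟨B, hB⟩ := isCompact_Icc.exists_bound_of_continuousOn hc
    refine ⟨|B|, abs_nonneg _, fun a h hh hmem => ⟨C (f a), by simp, by simp, ?_⟩⟩
    have hb : ∀ s ∈ Set.Icc (0 : ℝ) 1, |(derivative (C (f a))).eval s
        - h * derivWithin f (Set.Icc t0 tf) (a + s * h)| ≤ |B| * h ^ (0 + 1) := by
      intro s hs
      have := (hB _ (hmem s hs)).trans (le_abs_self B)
      rw [Real.norm_eq_abs] at this
      simp only [derivative_C, eval_zero, zero_sub, abs_neg, abs_mul, abs_of_nonneg hh, zero_add,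
        pow_one]
      rw [mul_comm]
      gcongr
    exact ⟨abs_eval_sub_le_of_derivative (hderiv 0 f hf) hmem (by simp) hb, hb⟩
  | succ n ih =>
    intro f hf
    obtain ⟨B, hB0, hB⟩ := ih (derivWithin f (Set.Icc t0 tf))
      (hf.derivWithin (uniqueDiffOn_Icc htf) (by norm_cast))
    refine ⟨B, hB0, fun a h hh hmem => ?_⟩
    obtain ⟨g, hgdeg, -, hg, -⟩ := hB a h hh hmem
    obtain ⟨v, hv, hv0, hvdeg⟩ := exists_antiderivative (C h * g) (f a)
    have hb : ∀ s ∈ Set.Icc (0 : ℝ) 1, |v.derivative.eval s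
        - h * derivWithin f (Set.Icc t0 tf) (a + s * h)| ≤ B * h ^ (n + 1 + 1) := by
      intro s hs
      rw [hv, eval_mul, eval_C, ← mul_sub, abs_mul, abs_of_nonneg hh]
      calc h * _ ≤ h * (B * h ^ (n + 1)) := by gcongr; exact hg s hs
        _ = _ := by ring
    refine ⟨v, hvdeg.trans (Nat.succ_le_succ ((natDegree_C_mul_le _ _).trans hgdeg)), hv0,
      abs_eval_sub_le_of_derivative (hderiv _ f hf) hmem hv0 hb, hb⟩

section Collocation

variable {N : ℕ} {τ : Fin (N + 1) → ℝ}

/-- A polynomial of degree at most `2N + 1` vanishing at the Gauss nodes has zero integral. -/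
theorem integral_eq_zero_of_eval_nodes_eq_zero (hτ : Function.Injective τ)
    (horth : ∀ j : ℕ, j ≤ N → ∫ ξ in (0:ℝ)..1, ξ ^ j * ∏ k, (ξ - τ k) = 0)
    {P : ℝ[X]} (hP : P.natDegree ≤ 2 * N + 1) (hroot : ∀ k, P.eval (τ k) = 0) :
    ∫ t in (0:ℝ)..1, P.eval t = 0 := by
  have hdvd : ∏ k, (X - C (τ k)) ∣ P :=
    Finset.prod_dvd_of_coprime (fun i _ j _ hij => pairwise_coprime_X_sub_C hτ hij)
      fun k _ => dvd_iff_isRoot.2 (hroot k)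
  obtain ⟨Q, rfl⟩ := hdvd
  have hmonic : (∏ k, (X - C (τ k))).Monic := monic_prod_of_monic _ _ fun k _ => monic_X_sub_C _
  have hQ : Q.natDegree ≤ N := by
    by_cases hQ0 : Q = 0
    · simp [hQ0]
    · rw [hmonic.natDegree_mul' hQ0,
        natDegree_prod_of_monic _ _ (fun k _ => monic_X_sub_C _)] at hP
      simp at hP
      omega
  have hrw : ∀ t : ℝ, (((∏ k, (X - C (τ k))) * Q).eval t) =
      ∑ j ∈ Finset.range (Q.natDegree + 1), Q.coeff j * (t ^ j * ∏ k, (t - τ k)) := by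
    intro t
    rw [eval_mul, eval_prod, Q.eval_eq_sum_range, Finset.mul_sum]
    simp only [eval_sub, eval_X, eval_C]
    exact Finset.sum_congr rfl fun j _ => by ring
  simp_rw [hrw]
  rw [intervalIntegral.integral_finsetSum]
  · refine Finset.sum_eq_zero fun j hj => ?_
    rw [intervalIntegral.integral_const_mul, horth j (by
      have := Finset.mem_range.1 hj
      omega), mul_zero]
  · intro j _
    exact Continuous.intervalIntegrable (by fun_prop) _ _

variable {φ : Fin (N + 1) → ℝ[X]}

/-- Lagrange interpolation reproduces polynomials of degree at most `N`. -/
theorem sum_eval_nodes_mul_eq (hτ : Function.Injective τ)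
    (hφdeg : ∀ p, (φ p).natDegree ≤ N)
    (hφeval : ∀ p q, (φ p).eval (τ q) = if p = q then 1 else 0)
    {v : ℝ[X]} (hv : v.natDegree ≤ N) : ∑ q, C (v.eval (τ q)) * φ q = v := by
  refine eq_of_degrees_lt_of_eval_index_eq (Finset.univ : Finset (Fin (N + 1))) hτ.injOn ?_ ?_ ?_
  · refine lt_of_le_of_lt (b := (N : WithBot ℕ)) ?_ (by simpa using Nat.cast_lt.2 N.lt_succ_self)
    refine degree_le_of_natDegree_le (natDegree_sum_le_of_forall_le _ _ fun q _ => ?_)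
    exact (natDegree_C_mul_le _ _).trans (hφdeg q)
  · exact lt_of_le_of_lt (degree_le_of_natDegree_le hv)
      (by simpa using Nat.cast_lt.2 N.lt_succ_self)
  · intro p _
    simp [eval_finsetSum, hφeval]

/-- The predictor matrix integrates derivatives of polynomials of degree at most `N` exactly. -/
theorem eval_node_eq_add_sum (hτ : Function.Injective τ)
    (horth : ∀ j : ℕ, j ≤ N → ∫ ξ in (0:ℝ)..1, ξ ^ j * ∏ k, (ξ - τ k) = 0)
    (hφdeg : ∀ p, (φ p).natDegree ≤ N)
    (hφeval : ∀ p q, (φ p).eval (τ q) = if p = q then 1 else 0)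
    {w : Fin (N + 1) → ℝ} (hw : ∀ p, w p = ∫ t in (0:ℝ)..1, (φ p).eval t)
    {K : Matrix (Fin (N + 1)) (Fin (N + 1)) ℝ}
    (hK : ∀ p q, K p q = (φ p).eval 0 * (φ q).eval 0 +
      ∫ t in (0:ℝ)..1, (φ p).eval t * (φ q).derivative.eval t)
    (hKdet : IsUnit K.det) {v : ℝ[X]} (hv : v.natDegree ≤ N) (p : Fin (N + 1)) :
    v.eval (τ p) = v.eval 0 +
      ∑ q, (K⁻¹ * Matrix.diagonal w) p q * v.derivative.eval (τ q) := by
  have hKv : ∀ v : ℝ[X], v.natDegree ≤ N →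
      K *ᵥ (fun q => v.eval (τ q)) =
        v.eval 0 • (fun p => (φ p).eval 0) + Matrix.diagonal w *ᵥ
          fun q => v.derivative.eval (τ q) := by
    intro v hv
    ext p
    have hint : ∫ t in (0:ℝ)..1, (φ p).eval t * v.derivative.eval t =
        w p * v.derivative.eval (τ p) := by
      have h0 := integral_eq_zero_of_eval_nodes_eq_zero hτ horth
        (P := φ p * (v.derivative - C (v.derivative.eval (τ p)))) (by
          refine natDegree_mul_le.trans ?_
          have h1 := hφdeg p
          have h2 : (v.derivative - C (v.derivative.eval (τ p))).natDegree ≤ N := by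
            rw [natDegree_sub_C]
            exact (natDegree_derivative_le v).trans (by omega)
          omega) (by
          intro k
          by_cases hpk : p = k
          · simp [hpk]
          · simp [hφeval, hpk])
      simp only [eval_mul, eval_sub, eval_C, mul_sub] at h0
      rw [intervalIntegral.integral_sub (Continuous.intervalIntegrable (by fun_prop) _ _)
        (Continuous.intervalIntegrable (by fun_prop) _ _),
        intervalIntegral.integral_mul_const, ← hw] at h0
      linarith
    have hsum : ∀ t, v.eval t = ∑ q, v.eval (τ q) * (φ q).eval t := by
      intro t
      conv_lhs => rw [← sum_eval_nodes_mul_eq hτ hφdeg hφeval hv]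
      simp [eval_finsetSum]
    have hsum' : ∀ t, v.derivative.eval t = ∑ q, v.eval (τ q) * (φ q).derivative.eval t := by
      intro t
      conv_lhs => rw [← sum_eval_nodes_mul_eq hτ hφdeg hφeval hv]
      simp [eval_finsetSum]
    have hint' : ∫ t in (0:ℝ)..1, (φ p).eval t * v.derivative.eval t =
        ∑ q, v.eval (τ q) * ∫ t in (0:ℝ)..1, (φ p).eval t * (φ q).derivative.eval t := by
      simp_rw [hsum', Finset.mul_sum]
      rw [intervalIntegral.integral_finsetSum fun q _ =>
        Continuous.intervalIntegrable (by fun_prop) _ _]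
      refine Finset.sum_congr rfl fun q _ => ?_
      rw [← intervalIntegral.integral_const_mul]
      congr 1
      ext t
      ring
    simp only [Matrix.mulVec, dotProduct, Pi.add_apply, Pi.smul_apply, smul_eq_mul, hK]
    have hdiag : ∀ x : Fin (N + 1) → ℝ, ∑ q, Matrix.diagonal w p q * x q = w p * x p := fun x => Matrix.mulVec_diagonal w x p
    rw [hdiag, ← hint, hint', hsum 0, Finset.sum_mul,
      ← Finset.sum_add_distrib]
    exact Finset.sum_congr rfl fun q _ => by ring
  have hK1 := hKv 1 (by simp)
  have h1 := hKv v hv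
  have hK1' : K *ᵥ (fun _ => (1 : ℝ)) = fun p => (φ p).eval 0 := by
    simpa [← Pi.zero_def] using hK1
  rw [← hK1'] at h1
  have h2 := congrArg (fun x => (K⁻¹ *ᵥ x) p) h1
  simp only [Matrix.mulVec_add, Matrix.mulVec_smul, Matrix.mulVec_mulVec,
    Matrix.nonsing_inv_mul K hKdet, Matrix.one_mulVec] at h2
  simpa [Matrix.mulVec, dotProduct] using h2

end Collocation


/-- Approximation order `N+1` of the local DG predictor solution. -/
theorem aderdg_local_solution_order
    (N : ℕ) (hN : 1 ≤ N)
    (τ : Fin (N + 1) → ℝ) (hτ : StrictMono τ)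
    (hτmem : ∀ k, τ k ∈ Set.Ioo (0 : ℝ) 1)
    (horth : ∀ j : ℕ, j ≤ N →
      ∫ ξ in (0:ℝ)..1, ξ ^ j * ∏ k, (ξ - τ k) = 0)
    (φ : Fin (N + 1) → Polynomial ℝ)
    (hφdeg : ∀ p, (φ p).natDegree ≤ N)
    (hφeval : ∀ p q, (φ p).eval (τ q) = if p = q then 1 else 0)
    (w : Fin (N + 1) → ℝ)
    (hw : ∀ p, w p = ∫ t in (0:ℝ)..1, (φ p).eval t)
    (K : Matrix (Fin (N + 1)) (Fin (N + 1)) ℝ)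
    (hK : ∀ p q, K p q = (φ p).eval 0 * (φ q).eval 0 +
      ∫ t in (0:ℝ)..1, (φ p).eval t * (φ q).derivative.eval t)
    (hKdet : IsUnit K.det)
    (A : Matrix (Fin (N + 1)) (Fin (N + 1)) ℝ)
    (hA : A = K⁻¹ * Matrix.diagonal w)
    (D : ℕ) (hD : 1 ≤ D) (t0 tf : ℝ) (htf : t0 < tf)
    (LF : ℝ) (hLF : 0 ≤ LF)
    (F : (Fin D → ℝ) → ℝ → (Fin D → ℝ))
    (hFlip : ∀ x y : Fin D → ℝ, ∀ t' ∈ Set.Icc t0 tf,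
      ‖F x t' - F y t'‖ ≤ LF * ‖x - y‖)
    (u : ℝ → Fin D → ℝ)
    (hu : ContDiffOn ℝ (N + 2 : ℕ) u (Set.Icc t0 tf))
    (hode : ∀ t' ∈ Set.Icc t0 tf,
      derivWithin u (Set.Icc t0 tf) t' = F (u t') t')
    (Cu : ℝ) (hCu : 0 ≤ Cu) :
    ∃ C > (0:ℝ), ∃ h0 > (0:ℝ),
      ∀ M : ℕ, 1 ≤ M → ∀ Δt : ℝ, Δt = (tf - t0) / M → Δt ≤ h0 →
        ∀ (un : ℕ → Fin D → ℝ) (qh : ℕ → Fin (N + 1) → Fin D → ℝ),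
          (∀ n < M, ∀ p, qh n p = un n + Δt •
            ∑ q, A p q • F (qh n q) (t0 + n * Δt + τ q * Δt)) →
          (∀ n ≤ M, ‖un n - u (t0 + n * Δt)‖ ≤ Cu * Δt ^ (2 * N + 1)) →
          ∀ n < M, ∀ τ' ∈ Set.Icc (0:ℝ) 1,
            ‖(∑ p, (φ p).eval τ' • qh n p) - u (t0 + n * Δt + τ' * Δt)‖ ≤
              C * Δt ^ (N + 1) := by
  have hinj := hτ.injective
  have hτI : ∀ q, τ q ∈ Set.Icc (0 : ℝ) 1 := fun q => Set.Ioo_subset_Icc_self (hτmem q)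
  have hui : ∀ i, ContDiffOn ℝ (N + 1 : ℕ) (fun t => u t i) (Set.Icc t0 tf) := fun i =>
    (contDiffOn_pi.1 hu i).of_le (by norm_cast; omega)
  choose Bi hBi0 hBi using fun i => exists_uniform_polynomial_approx htf N _ (hui i)
  have hderiv : ∀ i, ∀ t ∈ Set.Icc t0 tf,
      derivWithin (fun t => u t i) (Set.Icc t0 tf) t = F (u t) t i := by
    intro i t ht
    have hd := (hu.differentiableOn (by simp) t ht).hasDerivWithinAt
    rw [hode t ht] at hd
    exact (hasDerivWithinAt_pi.1 hd i).derivWithin (uniqueDiffOn_Icc htf t ht)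
  set B : ℝ := ∑ i, Bi i
  have hB0 : 0 ≤ B := Finset.sum_nonneg fun i _ => hBi0 i
  have hBle : ∀ i, Bi i ≤ B := fun i =>
    Finset.single_le_sum (fun i _ => hBi0 i) (Finset.mem_univ i)
  set a : ℝ := ∑ p, ∑ q, |A p q|
  have ha0 : 0 ≤ a := Finset.sum_nonneg fun p _ => Finset.sum_nonneg fun q _ => abs_nonneg _
  have hale : ∀ p, ∑ q, |A p q| ≤ a := fun p =>
    Finset.single_le_sum (f := fun p => ∑ q, |A p q|)
      (fun p _ => Finset.sum_nonneg fun q _ => abs_nonneg _) (Finset.mem_univ p)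
  have hAsum : ∀ p (x : Fin (N + 1) → ℝ) (c : ℝ), (∀ q, |x q| ≤ c) →
      |∑ q, A p q * x q| ≤ a * c := by
    intro p x c hx
    have hc : 0 ≤ c := (abs_nonneg _).trans (hx 0)
    calc |∑ q, A p q * x q| ≤ ∑ q, |A p q * x q| := Finset.abs_sum_le_sum_abs _ _
      _ ≤ ∑ q, |A p q| * c := by
        gcongr with q
        rw [abs_mul]
        gcongr
        exact hx q
      _ = (∑ q, |A p q|) * c := by rw [Finset.sum_mul]
      _ ≤ a * c := by gcongr; exact hale p
  obtain ⟨Λ, hΛ⟩ := (isCompact_Icc (a := (0 : ℝ)) (b := 1)).exists_bound_of_continuousOn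
    (f := fun s => ∑ p, |(φ p).eval s|) (by fun_prop)
  have hΛ0 : 0 ≤ Λ := (norm_nonneg _).trans (hΛ 0 (by simp))
  have hφsum : ∀ s ∈ Set.Icc (0 : ℝ) 1, ∀ (x : Fin (N + 1) → ℝ) (c : ℝ), (∀ q, |x q| ≤ c) →
      |∑ q, (φ q).eval s * x q| ≤ Λ * c := by
    intro s hs x c hx
    have hc : 0 ≤ c := (abs_nonneg _).trans (hx 0)
    calc |∑ q, (φ q).eval s * x q| ≤ ∑ q, |(φ q).eval s * x q| := Finset.abs_sum_le_sum_abs _ _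
      _ ≤ ∑ q, |(φ q).eval s| * c := by
        gcongr with q
        rw [abs_mul]
        gcongr
        exact hx q
      _ = (∑ q, |(φ q).eval s|) * c := by rw [Finset.sum_mul]
      _ ≤ Λ * c := by
        gcongr
        exact (le_abs_self _).trans (hΛ s hs)
  set E0 : ℝ := 2 * (Cu + a * B + B) with hE0
  have hE00 : 0 ≤ E0 := by positivity
  refine ⟨Λ * (E0 + B) + B + 1, by positivity, min 1 (1 / (2 * (a * LF + 1))),
    lt_min one_pos (by positivity), ?_⟩
  intro M hM Δt hΔ hΔle un qh hq hun n hn s hs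
  have hMpos : (0 : ℝ) < M := by exact_mod_cast hM
  have hΔpos : 0 < Δt := by rw [hΔ]; exact div_pos (sub_pos.2 htf) hMpos
  have hΔ1 : Δt ≤ 1 := hΔle.trans (min_le_left _ _)
  have hΔL : Δt * (a * LF) ≤ 1 / 2 := by
    have h := hΔle.trans (min_le_right _ _)
    rw [le_div_iff₀ (by positivity)] at h
    nlinarith
  have hmem : ∀ s ∈ Set.Icc (0 : ℝ) 1, t0 + n * Δt + s * Δt ∈ Set.Icc t0 tf := by
    intro s hs
    have h1 : (n : ℝ) + 1 ≤ M := by exact_mod_cast hn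
    have h2 : M * Δt = tf - t0 := by rw [hΔ]; field_simp
    have h3 : 0 ≤ (n : ℝ) * Δt := by positivity
    have h4 : 0 ≤ s * Δt := mul_nonneg hs.1 hΔpos.le
    have h5 : s * Δt ≤ Δt := mul_le_of_le_one_left hΔpos.le hs.2
    constructor <;> nlinarith
  set η : ℝ := Δt ^ (N + 1)
  have hη0 : 0 ≤ η := by positivity
  choose v hvdeg hv0 hv hv' using fun i => hBi i (t0 + n * Δt) Δt hΔpos.le hmem
  replace hv : ∀ i, ∀ s ∈ Set.Icc (0 : ℝ) 1,
      |(v i).eval s - u (t0 + n * Δt + s * Δt) i| ≤ B * η := fun i s hs =>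
    (hv i s hs).trans (by gcongr; exact hBle i)
  replace hv' : ∀ i, ∀ s ∈ Set.Icc (0 : ℝ) 1, |(v i).derivative.eval s -
      Δt * F (u (t0 + n * Δt + s * Δt)) (t0 + n * Δt + s * Δt) i| ≤ B * η := fun i s hs => by
    have h := hv' i s hs
    rw [hderiv i _ (hmem s hs)] at h
    exact h.trans (by gcongr; exact hBle i)
  set e : Fin (N + 1) → Fin D → ℝ := fun p => qh n p - u (t0 + n * Δt + τ p * Δt) with he
  have hebd : ∀ p i, |e p i| ≤ Cu * η + Δt * (a * (LF * ‖e‖)) + a * (B * η) + B * η := by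
    intro p i
    have hcol := eval_node_eq_add_sum hinj horth hφdeg hφeval hw hK hKdet (hvdeg i) p
    rw [← hA, hv0] at hcol
    have hqi : qh n p i = un n i + Δt *
        ∑ q, A p q * F (qh n q) (t0 + n * Δt + τ q * Δt) i := by
      conv_lhs => rw [hq n hn p]
      simp
    have hsplit : e p i = (un n - u (t0 + n * Δt)) i +
        Δt * ∑ q, A p q * (F (qh n q) (t0 + n * Δt + τ q * Δt) i -
          F (u (t0 + n * Δt + τ q * Δt)) (t0 + n * Δt + τ q * Δt) i) -
        ∑ q, A p q * ((v i).derivative.eval (τ q) -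
          Δt * F (u (t0 + n * Δt + τ q * Δt)) (t0 + n * Δt + τ q * Δt) i) +
        ((v i).eval (τ p) - u (t0 + n * Δt + τ p * Δt) i) := by
      simp only [he, Pi.sub_apply, mul_sub, Finset.sum_sub_distrib, hqi, hcol, Finset.mul_sum,
        mul_left_comm (A p _) Δt]
      ring
    have h1 : |(un n - u (t0 + n * Δt)) i| ≤ Cu * η :=
      (norm_le_pi_norm (un n - u (t0 + n * Δt)) i).trans ((hun n hn.le).trans (by
        gcongr
        exact pow_le_pow_of_le_one hΔpos.le hΔ1 (by omega)))
    have h2 : |Δt * ∑ q, A p q * (F (qh n q) (t0 + n * Δt + τ q * Δt) i -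
          F (u (t0 + n * Δt + τ q * Δt)) (t0 + n * Δt + τ q * Δt) i)| ≤
        Δt * (a * (LF * ‖e‖)) := by
      rw [abs_mul, abs_of_pos hΔpos]
      refine mul_le_mul_of_nonneg_left (hAsum p _ _ fun q => ?_) hΔpos.le
      refine (norm_le_pi_norm (F (qh n q) _ - F (u _) _) i).trans
        ((hFlip _ _ _ (hmem _ (hτI q))).trans ?_)
      gcongr
      exact norm_le_pi_norm e q
    have h3 := hAsum p _ _ fun q => hv' i (τ q) (hτI q)
    have h4 := hv i (τ p) (hτI p)
    rw [hsplit]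
    exact (abs_add_le _ _).trans (add_le_add ((abs_sub _ _).trans (add_le_add
      ((abs_add_le _ _).trans (add_le_add h1 h2)) h3)) h4)
  have hE : ‖e‖ ≤ E0 * η := by
    have hR : 0 ≤ Cu * η + Δt * (a * (LF * ‖e‖)) + a * (B * η) + B * η := by positivity
    have h : ‖e‖ ≤ _ := (pi_norm_le_iff_of_nonneg hR).2 fun p =>
      (pi_norm_le_iff_of_nonneg hR).2 fun i => hebd p i
    have h' := mul_le_mul_of_nonneg_right hΔL (norm_nonneg e)
    rw [hE0]
    linarith
  refine (pi_norm_le_iff_of_nonneg (by positivity)).2 fun i => ?_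
  have hlag : (v i).eval s = ∑ p, (φ p).eval s * (v i).eval (τ p) := by
    conv_lhs => rw [← sum_eval_nodes_mul_eq hinj hφdeg hφeval (hvdeg i)]
    simp [eval_finsetSum, mul_comm]
  have hsplit : ((∑ p, (φ p).eval s • qh n p) - u (t0 + n * Δt + s * Δt)) i =
      ∑ p, (φ p).eval s * (e p i - ((v i).eval (τ p) - u (t0 + n * Δt + τ p * Δt) i)) +
        ((v i).eval s - u (t0 + n * Δt + s * Δt) i) := by
    rw [hlag]
    simp only [he, Pi.sub_apply, Finset.sum_apply, Pi.smul_apply, smul_eq_mul, mul_sub,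
      Finset.sum_sub_distrib]
    ring
  rw [Real.norm_eq_abs, hsplit]
  have h1 := hφsum s hs
    (fun p => e p i - ((v i).eval (τ p) - u (t0 + n * Δt + τ p * Δt) i)) (E0 * η + B * η)
    fun p => (abs_sub _ _).trans (add_le_add
      (((norm_le_pi_norm (e p) i).trans (norm_le_pi_norm e p)).trans hE) (hv i _ (hτI p)))
  refine (abs_add_le _ _).trans ((add_le_add h1 (hv i s hs)).trans ?_)
  linarith
end
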